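/- Let X be an order complete Banach lattice whose normalized atoms form a Schauder basis (x_i) with biorthogonal functionals (x_i*), and set e_n := ∑_{i=1}^n x_i*⊗x_i. Let 𝒜 be a closed Riesz algebra ideal of ℒʳ(X) containing all e_n, and let τ be the locally convex topology on 𝒜 generated by the seminorms a ↦ ‖ab‖ᵣ + ‖ba‖ᵣ for b ∈ ℱ(X). Then: (a) (𝒜, τ) is a Hausdorff locally convex topological vector space in which multiplication is separately continuous; (b) 𝒜₊ is τ-closed; and (c) if (x_i) is shrinking, then (e_n) is an approximate identity for (𝒜, τ), i.e., τ-lim_n e_n a = a = τ-lim_n a e_n for every a ∈ 𝒜. -/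

import Mathlib

/- STATEMENT 17: the strict topology τ on a closed Riesz algebra ideal 𝒜 of ℒʳ(X)
   defined by the seminorms a ↦ ‖ab‖ᵣ + ‖ba‖ᵣ (b ∈ ℱ(X)): (a) it is a Hausdorff
   locally convex linear topology with separately continuous multiplication;
   (b) 𝒜₊ is τ-closed; (c) if the basis is shrinking, (e n) is a τ-approximate
   identity for 𝒜. -/

open Filter Topology

section Prelude

variable {X : Type*} [NormedAddCommGroup X] [Lattice X] [HasSolidNorm X] [IsOrderedAddMonoid X] [NormedSpace ℝ X]

/-- A bounded operator is positive if it maps the positive cone into itself. -/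
def IsPosOp (T : X →L[ℝ] X) : Prop := ∀ x : X, 0 ≤ x → 0 ≤ T x

/-- The operator order on regular operators. -/
def opLe (S T : X →L[ℝ] X) : Prop := IsPosOp (T - S)

/-- ℒʳ(X): the regular operators, i.e. linear combinations of positive operators. -/
def LrSet (X : Type*) [NormedAddCommGroup X] [Lattice X] [HasSolidNorm X] [IsOrderedAddMonoid X] [NormedSpace ℝ X] :
    Set (X →L[ℝ] X) :=
  {T | ∃ (n : ℕ) (c : Fin n → ℝ) (S : Fin n → X →L[ℝ] X),
    (∀ i, IsPosOp (S i)) ∧ T = ∑ i, c i • S i}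

/-- The regular norm ‖T‖ᵣ = inf{‖S‖ : |Tx| ≤ S|x| for all x}. -/
noncomputable def rnorm (T : X →L[ℝ] X) : ℝ :=
  sInf {c : ℝ | ∃ S : X →L[ℝ] X, ‖S‖ = c ∧ ∀ x : X, |T x| ≤ S |x|}

/-- ℱ(X): continuous finite-rank operators. -/
def FinRankOp (T : X →L[ℝ] X) : Prop :=
  ∃ (n : ℕ) (f : Fin n → X →L[ℝ] ℝ) (v : Fin n → X), T = ∑ i, (f i).smulRight (v i)

/-- x is a normalized atom of the Banach lattice X. -/
def IsNormAtom (a : X) : Prop :=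
  0 < a ∧ ‖a‖ = 1 ∧ ∀ y : X, 0 ≤ y → y ≤ a → ∃ c : ℝ, y = c • a

/-- The strict topology defined by the seminorms a ↦ ‖ab‖ᵣ + ‖ba‖ᵣ, b ∈ ℱ(X). -/
noncomputable def strictTopology (X : Type*) [NormedAddCommGroup X] [Lattice X] [HasSolidNorm X] [IsOrderedAddMonoid X]
    [NormedSpace ℝ X] : TopologicalSpace (X →L[ℝ] X) :=
  TopologicalSpace.generateFrom
    {U | ∃ (a₀ : X →L[ℝ] X) (s : Finset (X →L[ℝ] X)) (ε : ℝ), 0 < ε ∧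
      (∀ b ∈ s, FinRankOp b) ∧
      U = {x | ∀ b ∈ s, rnorm ((x - a₀) ∘L b) + rnorm (b ∘L (x - a₀)) < ε}}

end Prelude

set_option linter.unusedSectionVars false

section OrderedModule

/-- A normed lattice over `ℝ` with solid norm is an ordered module. -/
instance HasSolidNorm.instIsOrderedModule {X : Type*} [NormedAddCommGroup X] [Lattice X]
    [HasSolidNorm X] [IsOrderedAddMonoid X] [NormedSpace ℝ X] : IsOrderedModule ℝ X := by
  have half : ∀ (n : ℕ) (y : X), 0 ≤ y → 0 ≤ ((2 : ℝ) ^ n)⁻¹ • y := by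
    intro n
    induction n with
    | zero => intro y hy; simpa using hy
    | succ n ih =>
      intro y hy
      refine nsmul_two_semiclosed ?_
      have h : (2 : ℕ) • (((2 : ℝ) ^ (n + 1))⁻¹ • y) = ((2 : ℝ) ^ n)⁻¹ • y := by
        rw [two_nsmul, ← add_smul, pow_succ]
        congr 1
        field_simp
        norm_num
      rw [h]
      exact ih y hy
  have main : ∀ (c : ℝ) (y : X), 0 ≤ c → 0 ≤ y → 0 ≤ c • y := by
    intro c y hc hy
    have hpow : Tendsto (fun n : ℕ => (2 : ℝ) ^ n) atTop atTop :=
      tendsto_pow_atTop_atTop_of_one_lt one_lt_two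
    have hlim : Tendsto (fun n : ℕ => ((⌊c * (2 : ℝ) ^ n⌋₊ : ℝ) / (2 : ℝ) ^ n) • y)
        atTop (𝓝 (c • y)) :=
      ((tendsto_nat_floor_mul_div_atTop hc).comp hpow).smul_const y
    refine ge_of_tendsto' hlim fun n => ?_
    rw [div_eq_mul_inv, mul_smul, Nat.cast_smul_eq_nsmul]
    exact nsmul_nonneg (half n y hy) _
  have : PosSMulMono ℝ X := ⟨fun c hc y z hyz => by
    have := main c (z - y) hc (sub_nonneg.2 hyz)
    rwa [smul_sub, sub_nonneg] at this⟩
  have : SMulPosMono ℝ X := ⟨fun y hy c d hcd => by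
    have := main (d - c) y (sub_nonneg.2 hcd) hy
    rwa [sub_smul, sub_nonneg] at this⟩
  exact {}

end OrderedModule

section LatticeGroup

theorem inf_add_le_inf_add_inf {X : Type*} [AddCommGroup X] [Lattice X] [IsOrderedAddMonoid X]
    {a b c : X} (ha : 0 ≤ a) (hb : 0 ≤ b) (hc : 0 ≤ c) : a ⊓ (b + c) ≤ a ⊓ b + a ⊓ c := by
  rw [add_inf, inf_add, inf_add]
  refine le_inf (le_inf ?_ ?_) (le_inf ?_ inf_le_right)
  · exact inf_le_left.trans (le_add_of_nonneg_left ha)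
  · exact inf_le_left.trans (le_add_of_nonneg_left hb)
  · exact inf_le_left.trans (le_add_of_nonneg_right hc)

theorem inf_sum_le_sum_inf {X ι : Type*} [AddCommGroup X] [Lattice X] [IsOrderedAddMonoid X]
    {a : X} (ha : 0 ≤ a) (s : Finset ι) {f : ι → X} (hf : ∀ i ∈ s, 0 ≤ f i) :
    a ⊓ ∑ i ∈ s, f i ≤ ∑ i ∈ s, a ⊓ f i := by
  classical
  induction s using Finset.induction_on with
  | empty => simp
  | insert i s his ih =>
    rw [Finset.sum_insert his, Finset.sum_insert his]
    have hs : ∀ j ∈ s, 0 ≤ f j := fun j hj => hf j (Finset.mem_insert_of_mem hj)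
    exact (inf_add_le_inf_add_inf ha (hf i (Finset.mem_insert_self _ _))
      (Finset.sum_nonneg hs)).trans (add_le_add_right (ih hs) _)

end LatticeGroup

section Lattice

variable {X : Type*} [NormedAddCommGroup X] [Lattice X] [HasSolidNorm X] [IsOrderedAddMonoid X]
  [NormedSpace ℝ X]

theorem abs_real_smul_le (c : ℝ) (y : X) : |c • y| ≤ |c| • |y| := by
  rcases le_total 0 c with hc | hc
  · rw [abs_of_nonneg hc, abs_le', ← smul_neg]
    exact ⟨smul_le_smul_of_nonneg_left (le_abs_self y) hc,
      smul_le_smul_of_nonneg_left (neg_le_abs y) hc⟩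
  · rw [abs_of_nonpos hc, abs_le', ← neg_smul, ← neg_smul_neg c y]
    exact ⟨smul_le_smul_of_nonneg_left (neg_le_abs y) (neg_nonneg.2 hc),
      smul_le_smul_of_nonneg_left (le_abs_self y) (neg_nonneg.2 hc)⟩

theorem IsNormAtom.eq_smul_of_le_smul {a : X} (ha : IsNormAtom a) {c : ℝ} (hc : 0 ≤ c) {y : X}
    (hy : 0 ≤ y) (hya : y ≤ c • a) : ∃ d : ℝ, y = d • a := by
  rcases hc.eq_or_lt with rfl | hc
  · exact ⟨0, le_antisymm (by simpa using hya) (by simpa using hy)⟩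
  · obtain ⟨d, hd⟩ := ha.2.2 (c⁻¹ • y) (smul_nonneg (inv_nonneg.2 hc.le) hy) (by
      simpa [smul_smul, inv_mul_cancel₀ hc.ne'] using
        smul_le_smul_of_nonneg_left hya (inv_nonneg.2 hc.le))
    exact ⟨c * d, by rw [mul_smul, ← hd, smul_smul, mul_inv_cancel₀ hc.ne', one_smul]⟩

section Basis

variable {x : ℕ → X} {xs : ℕ → X →L[ℝ] ℝ}

theorem smul_atom_inf_smul_atom (hatom : ∀ i, IsNormAtom (x i))
    (hbi : ∀ i j, xs i (x j) = if i = j then (1 : ℝ) else 0) {i j : ℕ} (hij : i ≠ j)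
    {a b : ℝ} (ha : 0 ≤ a) (hb : 0 ≤ b) : (a • x i) ⊓ (b • x j) = 0 := by
  have h0 : 0 ≤ (a • x i) ⊓ (b • x j) :=
    le_inf (smul_nonneg ha (hatom i).1.le) (smul_nonneg hb (hatom j).1.le)
  obtain ⟨c, hc⟩ := (hatom i).eq_smul_of_le_smul ha h0 inf_le_left
  obtain ⟨d, hd⟩ := (hatom j).eq_smul_of_le_smul hb h0 inf_le_right
  have h : xs i (c • x i) = xs i (d • x j) := by rw [← hc, ← hd]
  simp only [map_smul, hbi, if_neg hij, smul_eq_mul] at h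
  have hc0 : c = 0 := by simpa using h
  rw [hc, hc0, zero_smul]

theorem coord_nonneg (hatom : ∀ i, IsNormAtom (x i))
    (hbi : ∀ i j, xs i (x j) = if i = j then (1 : ℝ) else 0)
    (hbasis : ∀ y : X, Tendsto (fun n => ∑ i ∈ Finset.range n, xs i y • x i) atTop (𝓝 y))
    (i : ℕ) {y : X} (hy : 0 ≤ y) : 0 ≤ xs i y := by
  by_contra! hneg
  have key : ∀ n, i < n → -xs i y ≤ ‖y - ∑ j ∈ Finset.range n, xs j y • x j‖ := by
    intro n hn
    set s := ∑ j ∈ Finset.range n, xs j y • x j with hs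
    set W := ∑ j ∈ (Finset.range n).erase i, |xs j y| • x j with hW
    have hx : ∀ j, 0 ≤ x j := fun j => (hatom j).1.le
    have hxi : 0 ≤ (-xs i y) • x i := smul_nonneg (by linarith) (hx i)
    have hWterm : ∀ j ∈ (Finset.range n).erase i, 0 ≤ |xs j y| • x j :=
      fun j _ => smul_nonneg (abs_nonneg _) (hx j)
    have hsplit : s = xs i y • x i + ∑ j ∈ (Finset.range n).erase i, xs j y • x j :=
      (Finset.add_sum_erase _ _ (Finset.mem_range.2 hn)).symm
    have hle : (-xs i y) • x i ≤ W + |y - s| := by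
      have h1 : ∑ j ∈ (Finset.range n).erase i, xs j y • x j ≤ W :=
        Finset.sum_le_sum fun j _ => smul_le_smul_of_nonneg_right (le_abs_self _) (hx j)
      have h2 : -s ≤ |y - s| := (by simpa [sub_eq_add_neg] using hy : -s ≤ y - s).trans
        (le_abs_self _)
      have h3 : (-xs i y) • x i = ∑ j ∈ (Finset.range n).erase i, xs j y • x j + -s := by
        rw [hsplit, neg_smul]; abel
      rw [h3]
      exact add_le_add h1 h2
    have hWinf : ((-xs i y) • x i) ⊓ W ≤ 0 :=
      (inf_sum_le_sum_inf hxi _ hWterm).trans (Finset.sum_nonpos fun j hj =>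
        (smul_atom_inf_smul_atom hatom hbi (Finset.ne_of_mem_erase hj).symm (by linarith)
          (abs_nonneg _)).le)
    have hfin : (-xs i y) • x i ≤ |y - s| :=
      calc (-xs i y) • x i = ((-xs i y) • x i) ⊓ (W + |y - s|) := (inf_eq_left.2 hle).symm
        _ ≤ ((-xs i y) • x i) ⊓ W + ((-xs i y) • x i) ⊓ |y - s| :=
          inf_add_le_inf_add_inf hxi (Finset.sum_nonneg hWterm) (abs_nonneg _)
        _ ≤ 0 + |y - s| := add_le_add hWinf inf_le_right
        _ = |y - s| := zero_add _
    have hnorm := norm_le_norm_of_abs_le_abs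
      (by rwa [abs_of_nonneg hxi] : |(-xs i y) • x i| ≤ |y - s|)
    rwa [norm_smul, (hatom i).2.1, mul_one, Real.norm_of_nonneg (by linarith)] at hnorm
  have hlim : Tendsto (fun n => ‖y - ∑ j ∈ Finset.range n, xs j y • x j‖) atTop (𝓝 0) := by
    simpa using ((tendsto_const_nhds (x := y)).sub (hbasis y)).norm
  have := ge_of_tendsto hlim ((eventually_gt_atTop i).mono key)
  linarith

theorem abs_coord_le (hatom : ∀ i, IsNormAtom (x i))
    (hbi : ∀ i j, xs i (x j) = if i = j then (1 : ℝ) else 0)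
    (hbasis : ∀ y : X, Tendsto (fun n => ∑ i ∈ Finset.range n, xs i y • x i) atTop (𝓝 y))
    (i : ℕ) (y : X) : |xs i y| ≤ xs i |y| := by
  have h1 := coord_nonneg hatom hbi hbasis i (sub_nonneg.2 (le_abs_self y))
  have h2 := coord_nonneg hatom hbi hbasis i (sub_nonneg.2 (neg_le_abs y))
  rw [map_sub] at h1 h2
  rw [map_neg] at h2
  exact abs_le'.2 ⟨by linarith, by linarith⟩

theorem partial_sum_le (hatom : ∀ i, IsNormAtom (x i))
    (hbi : ∀ i j, xs i (x j) = if i = j then (1 : ℝ) else 0)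
    (hbasis : ∀ y : X, Tendsto (fun n => ∑ i ∈ Finset.range n, xs i y • x i) atTop (𝓝 y))
    (n : ℕ) {y : X} (hy : 0 ≤ y) : ∑ i ∈ Finset.range n, xs i y • x i ≤ y :=
  ge_of_tendsto (hbasis y) ((eventually_ge_atTop n).mono fun _ hm =>
    Finset.sum_le_sum_of_subset_of_nonneg (Finset.range_mono hm) fun i _ _ =>
      smul_nonneg (coord_nonneg hatom hbi hbasis i hy) (hatom i).1.le)

theorem sum_abs_mul_coord_le (hatom : ∀ i, IsNormAtom (x i))
    (hbi : ∀ i j, xs i (x j) = if i = j then (1 : ℝ) else 0)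
    (hbasis : ∀ y : X, Tendsto (fun n => ∑ i ∈ Finset.range n, xs i y • x i) atTop (𝓝 y))
    (l : X →L[ℝ] ℝ) (y : X) (n : ℕ) :
    ∑ i ∈ Finset.range n, |l (x i)| * xs i |y| ≤ ‖l‖ * ‖y‖ := by
  have hsign : ∀ a : ℝ, ∃ s : ℝ, |s| ≤ 1 ∧ s * a = |a| := fun a => by
    rcases le_total 0 a with h | h
    · exact ⟨1, by simp, by rw [abs_of_nonneg h, one_mul]⟩
    · exact ⟨-1, by simp, by rw [abs_of_nonpos h, neg_one_mul]⟩
  choose s hs1 hs using fun i => hsign (l (x i))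
  set w := ∑ i ∈ Finset.range n, (s i * xs i |y|) • x i with hw
  have hc : ∀ i, 0 ≤ xs i |y| := fun i => coord_nonneg hatom hbi hbasis i (abs_nonneg y)
  have hlw : ∑ i ∈ Finset.range n, |l (x i)| * xs i |y| = l w := by
    rw [hw, map_sum]
    refine Finset.sum_congr rfl fun i _ => ?_
    rw [map_smul, smul_eq_mul, ← hs i]
    ring
  have hb : ∀ i, |s i * (xs i |y|)| ≤ xs i |y| := fun i => by
    rw [abs_mul, abs_of_nonneg (hc i)]
    exact mul_le_of_le_one_left (hc i) (hs1 i)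
  have hx : ∀ i, 0 ≤ x i := fun i => (hatom i).1.le
  have hwy : |w| ≤ |y| := by
    refine le_trans ?_ (partial_sum_le hatom hbi hbasis n (abs_nonneg y))
    rw [abs_le', hw, ← Finset.sum_neg_distrib]
    refine ⟨Finset.sum_le_sum fun i _ => ?_, Finset.sum_le_sum fun i _ => ?_⟩
    · exact smul_le_smul_of_nonneg_right ((le_abs_self _).trans (hb i)) (hx i)
    · rw [← neg_smul]
      exact smul_le_smul_of_nonneg_right ((neg_le_abs _).trans (hb i)) (hx i)
  rw [hlw]
  exact ((le_abs_self _).trans (l.le_opNorm w)).trans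
    (mul_le_mul_of_nonneg_left (norm_le_norm_of_abs_le_abs hwy) (norm_nonneg l))

/-- Every bounded functional is dominated by a positive functional of no larger norm. -/
theorem exists_dominating_functional (hatom : ∀ i, IsNormAtom (x i))
    (hbi : ∀ i j, xs i (x j) = if i = j then (1 : ℝ) else 0)
    (hbasis : ∀ y : X, Tendsto (fun n => ∑ i ∈ Finset.range n, xs i y • x i) atTop (𝓝 y))
    (l : X →L[ℝ] ℝ) : ∃ m : X →L[ℝ] ℝ, ‖m‖ ≤ ‖l‖ ∧ ∀ y, |l y| ≤ m |y| := by
  have hc : ∀ i (y : X), 0 ≤ xs i |y| := fun i y =>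
    coord_nonneg hatom hbi hbasis i (abs_nonneg y)
  have hsum := sum_abs_mul_coord_le hatom hbi hbasis l
  have hterm : ∀ i y, ‖|l (x i)| * xs i y‖ ≤ |l (x i)| * xs i |y| := fun i y => by
    rw [norm_mul, Real.norm_eq_abs, Real.norm_eq_abs, abs_abs]
    exact mul_le_mul_of_nonneg_left (abs_coord_le hatom hbi hbasis i y) (abs_nonneg _)
  have hpos : ∀ i y, 0 ≤ |l (x i)| * xs i |y| := fun i y => mul_nonneg (abs_nonneg _) (hc i y)
  have hsabs : ∀ y, Summable fun i => |l (x i)| * xs i |y| := fun y =>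
    summable_of_sum_range_le (fun i => hpos i y) (hsum y)
  have hs : ∀ y, Summable fun i => |l (x i)| * xs i y := fun y =>
    Summable.of_norm_bounded (hsabs y) fun i => hterm i y
  let L : X →ₗ[ℝ] ℝ :=
    { toFun := fun y => ∑' i, |l (x i)| * xs i y
      map_add' := fun y z => by
        rw [← (hs y).tsum_add (hs z)]
        exact tsum_congr fun i => by rw [map_add, mul_add]
      map_smul' := fun c y => by
        rw [RingHom.id_apply, smul_eq_mul, ← tsum_mul_left]
        exact tsum_congr fun i => by rw [map_smul, smul_eq_mul]; ring }
  have hL : ∀ y, ‖L y‖ ≤ ‖l‖ * ‖y‖ := fun y =>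
    (tsum_of_norm_bounded (hsabs y).hasSum fun i => hterm i y).trans
      (Real.tsum_le_of_sum_range_le (fun i => hpos i y) (hsum y))
  refine ⟨L.mkContinuous ‖l‖ hL, L.mkContinuous_norm_le (norm_nonneg l) hL, fun y => ?_⟩
  have hlim : Tendsto (fun n => |∑ i ∈ Finset.range n, xs i y * l (x i)|) atTop (𝓝 |l y|) := by
    have := ((l.continuous.tendsto y).comp (hbasis y)).abs
    simpa [Function.comp_def, map_sum] using this
  refine le_of_tendsto' hlim fun n => ?_
  calc |∑ i ∈ Finset.range n, xs i y * l (x i)|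
      ≤ ∑ i ∈ Finset.range n, |xs i y * l (x i)| := Finset.abs_sum_le_sum_abs _ _
    _ ≤ ∑ i ∈ Finset.range n, |l (x i)| * xs i |y| := Finset.sum_le_sum fun i _ => by
        rw [abs_mul, mul_comm]
        exact mul_le_mul_of_nonneg_left (abs_coord_le hatom hbi hbasis i y) (abs_nonneg _)
    _ ≤ L |y| := (hsabs y).sum_le_tsum _ fun i _ => hpos i y

end Basis

end Lattice

section SeminormTopology

/-- The topology generated by all balls of finite subfamilies of a family of seminorms is the
locally convex topology of that family. -/
theorem withSeminorms_generateFrom {E ι : Type*} [AddCommGroup E] [Module ℝ E]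
    (p : SeminormFamily ℝ E ι) :
    @WithSeminorms ℝ E ι _ _ _ p (TopologicalSpace.generateFrom
      {U | ∃ (a₀ : E) (s : Finset ι) (ε : ℝ), 0 < ε ∧
        U = {x | ∀ i ∈ s, p i (x - a₀) < ε}}) := by
  refine @WithSeminorms.mk _ _ _ _ _ _ _ (_) ?_
  let _ : TopologicalSpace E := p.moduleFilterBasis.topology
  have hp : WithSeminorms p := ⟨rfl⟩
  have := hp.topologicalAddGroup
  refine le_antisymm ?_ (le_generateFrom ?_)
  · intro U hU
    refine (@isOpen_iff_forall_mem_open _ (TopologicalSpace.generateFrom _) _).2 fun y hy => ?_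
    obtain ⟨s, r, hr, hsub⟩ := (hp.isOpen_iff_mem_balls U).1 hU y hy
    refine ⟨{z | ∀ i ∈ s, p i (z - y) < r}, fun z hz => hsub ?_,
      TopologicalSpace.GenerateOpen.basic _ ⟨y, s, r, hr, rfl⟩, fun i _ => by simpa using hr⟩
    rw [Seminorm.mem_ball]
    exact Seminorm.finset_sup_apply_lt hr hz
  · rintro U ⟨a₀, s, ε, -, rfl⟩
    simp only [Set.ofPred_forall]
    exact isOpen_biInter_finset fun i _ =>
      isOpen_lt ((hp.continuous_seminorm i).comp (continuous_id.sub continuous_const))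
        continuous_const

end SeminormTopology

section RegularNorm

variable {X : Type*} [NormedAddCommGroup X] [Lattice X] [HasSolidNorm X] [IsOrderedAddMonoid X]
  [NormedSpace ℝ X]

/-- `T` is dominated by `S` if `|T y| ≤ S |y|` for all `y`. -/
def IsDominatedBy (T S : X →L[ℝ] X) : Prop := ∀ y : X, |T y| ≤ S |y|

theorem IsDominatedBy.apply_nonneg {T S : X →L[ℝ] X} (h : IsDominatedBy T S) {y : X}
    (hy : 0 ≤ y) : 0 ≤ S y := by
  have := (abs_nonneg _).trans (h y)
  rwa [abs_of_nonneg hy] at this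

theorem IsDominatedBy.apply_mono {T S : X →L[ℝ] X} (h : IsDominatedBy T S) {y z : X}
    (hyz : y ≤ z) : S y ≤ S z := by
  have := h.apply_nonneg (sub_nonneg.2 hyz)
  rwa [map_sub, sub_nonneg] at this

theorem IsDominatedBy.add {T S U V : X →L[ℝ] X} (h : IsDominatedBy T S)
    (h' : IsDominatedBy U V) : IsDominatedBy (T + U) (S + V) :=
  fun y => (abs_add_le _ _).trans (add_le_add (h y) (h' y))

theorem IsDominatedBy.smul {T S : X →L[ℝ] X} (h : IsDominatedBy T S) (c : ℝ) :
    IsDominatedBy (c • T) (|c| • S) :=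
  fun y => (abs_real_smul_le c (T y)).trans (smul_le_smul_of_nonneg_left (h y) (abs_nonneg c))

theorem IsDominatedBy.comp {T S U V : X →L[ℝ] X} (h : IsDominatedBy T S)
    (h' : IsDominatedBy U V) : IsDominatedBy (T ∘L U) (S ∘L V) :=
  fun y => (h (U y)).trans (h.apply_mono (h' y))

theorem isDominatedBy_zero : IsDominatedBy (0 : X →L[ℝ] X) 0 := fun y => by simp

theorem IsDominatedBy.sum {ι : Type*} (s : Finset ι) {T S : ι → X →L[ℝ] X}
    (h : ∀ i ∈ s, IsDominatedBy (T i) (S i)) : IsDominatedBy (∑ i ∈ s, T i) (∑ i ∈ s, S i) := by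
  classical
  induction s using Finset.induction_on with
  | empty => simpa using isDominatedBy_zero
  | insert i s his ih =>
    rw [Finset.sum_insert his, Finset.sum_insert his]
    exact (h i (Finset.mem_insert_self _ _)).add
      (ih fun j hj => h j (Finset.mem_insert_of_mem hj))

theorem IsPosOp.isDominatedBy_self {S : X →L[ℝ] X} (hS : IsPosOp S) : IsDominatedBy S S := by
  intro y
  have h1 := hS _ (sub_nonneg.2 (le_abs_self y))
  have h2 := hS _ (sub_nonneg.2 (neg_le_abs y))
  rw [map_sub, sub_nonneg] at h1 h2
  rw [map_neg] at h2
  exact abs_le'.2 ⟨h1, h2⟩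

theorem exists_isDominatedBy_of_mem_LrSet {T : X →L[ℝ] X} (hT : T ∈ LrSet X) :
    ∃ S, IsDominatedBy T S := by
  obtain ⟨n, c, S, hS, rfl⟩ := hT
  exact ⟨_, IsDominatedBy.sum _ fun i _ => (hS i).isDominatedBy_self.smul (c i)⟩

theorem rnorm_nonneg (T : X →L[ℝ] X) : 0 ≤ rnorm T :=
  Real.sInf_nonneg fun _ ⟨_, hc, _⟩ => hc ▸ norm_nonneg _

theorem IsDominatedBy.rnorm_le {T S : X →L[ℝ] X} (h : IsDominatedBy T S) : rnorm T ≤ ‖S‖ :=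
  csInf_le ⟨0, fun _ ⟨_, hc, _⟩ => hc ▸ norm_nonneg _⟩ ⟨S, rfl, h⟩

theorem le_rnorm {T : X →L[ℝ] X} (hT : ∃ S, IsDominatedBy T S) {r : ℝ}
    (h : ∀ S, IsDominatedBy T S → r ≤ ‖S‖) : r ≤ rnorm T := by
  obtain ⟨S, hS⟩ := hT
  exact le_csInf ⟨_, S, rfl, hS⟩ fun _ ⟨V, hc, hV⟩ => hc ▸ h V hV

theorem le_mul_rnorm {T : X →L[ℝ] X} (hT : ∃ S, IsDominatedBy T S) {C r : ℝ} (hC : 0 ≤ C)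
    (h : ∀ S, IsDominatedBy T S → r ≤ C * ‖S‖) : r ≤ C * rnorm T := by
  rcases hC.eq_or_lt with rfl | hC
  · obtain ⟨S, hS⟩ := hT
    simpa using h S hS
  · rw [← div_le_iff₀' hC]
    exact le_rnorm hT fun S hS => (div_le_iff₀' hC).2 (h S hS)

theorem rnorm_zero : rnorm (0 : X →L[ℝ] X) = 0 :=
  le_antisymm (by simpa using (isDominatedBy_zero (X := X)).rnorm_le) (rnorm_nonneg _)

theorem rnorm_smul_le {T : X →L[ℝ] X} (hT : ∃ S, IsDominatedBy T S) (c : ℝ) :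
    rnorm (c • T) ≤ |c| * rnorm T :=
  le_mul_rnorm hT (abs_nonneg c) fun S hS =>
    (hS.smul c).rnorm_le.trans_eq (by rw [norm_smul, Real.norm_eq_abs, abs_abs])

theorem rnorm_add_le {T U : X →L[ℝ] X} (hT : ∃ S, IsDominatedBy T S)
    (hU : ∃ S, IsDominatedBy U S) : rnorm (T + U) ≤ rnorm T + rnorm U := by
  rw [← sub_le_iff_le_add]
  refine le_rnorm hT fun S hS => ?_
  rw [sub_le_comm]
  refine le_rnorm hU fun V hV => ?_
  rw [sub_le_iff_le_add']
  exact (hS.add hV).rnorm_le.trans (norm_add_le _ _)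

theorem IsDominatedBy.rnorm_comp_left_le {a S T : X →L[ℝ] X} (ha : IsDominatedBy a S)
    (hT : ∃ S, IsDominatedBy T S) : rnorm (a ∘L T) ≤ ‖S‖ * rnorm T :=
  le_mul_rnorm hT (norm_nonneg S) fun V hV =>
    (ha.comp hV).rnorm_le.trans (S.opNorm_comp_le V)

theorem IsDominatedBy.rnorm_comp_right_le {a S T : X →L[ℝ] X} (ha : IsDominatedBy a S)
    (hT : ∃ S, IsDominatedBy T S) : rnorm (T ∘L a) ≤ ‖S‖ * rnorm T :=
  le_mul_rnorm hT (norm_nonneg S) fun V hV =>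
    ((hV.comp ha).rnorm_le.trans (V.opNorm_comp_le S)).trans_eq (mul_comm _ _)

theorem norm_le_rnorm {T : X →L[ℝ] X} (hT : ∃ S, IsDominatedBy T S) : ‖T‖ ≤ rnorm T :=
  le_rnorm hT fun S hS => T.opNorm_le_bound (norm_nonneg S) fun y => by
    calc ‖T y‖ ≤ ‖S |y|‖ := norm_le_norm_of_abs_le_abs ((hS y).trans (le_abs_self _))
      _ ≤ ‖S‖ * ‖y‖ := by simpa only [norm_abs_eq_norm] using S.le_opNorm |y|

theorem FinRankOp.comp_left {b : X →L[ℝ] X} (hb : FinRankOp b) (a : X →L[ℝ] X) :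
    FinRankOp (a ∘L b) := by
  obtain ⟨n, f, v, rfl⟩ := hb
  exact ⟨n, f, fun i => a (v i), by ext y; simp⟩

theorem FinRankOp.comp_right {b : X →L[ℝ] X} (hb : FinRankOp b) (a : X →L[ℝ] X) :
    FinRankOp (b ∘L a) := by
  obtain ⟨n, f, v, rfl⟩ := hb
  exact ⟨n, fun i => f i ∘L a, v, by ext y; simp⟩

theorem finRankOp_smulRight (l : X →L[ℝ] ℝ) (y : X) : FinRankOp (l.smulRight y) :=
  ⟨1, fun _ => l, fun _ => y, by simp⟩

variable (hdual : ∀ l : X →L[ℝ] ℝ, ∃ m : X →L[ℝ] ℝ, ‖m‖ ≤ ‖l‖ ∧ ∀ y, |l y| ≤ m |y|)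

include hdual

theorem exists_isDominatedBy_smulRight (l : X →L[ℝ] ℝ) (v : X) :
    ∃ S, IsDominatedBy (l.smulRight v) S ∧ ‖S‖ ≤ ‖l‖ * ‖v‖ := by
  obtain ⟨m, hm, hlm⟩ := hdual l
  refine ⟨m.smulRight |v|, fun y => ?_, ?_⟩
  · exact (abs_real_smul_le (l y) v).trans
      (smul_le_smul_of_nonneg_right (hlm y) (abs_nonneg v))
  · rw [ContinuousLinearMap.norm_smulRight_apply, norm_abs_eq_norm]
    exact mul_le_mul_of_nonneg_right hm (norm_nonneg v)

theorem FinRankOp.exists_isDominatedBy {b : X →L[ℝ] X} (hb : FinRankOp b) :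
    ∃ S, IsDominatedBy b S := by
  obtain ⟨n, f, v, rfl⟩ := hb
  choose S hS _ using fun i => exists_isDominatedBy_smulRight hdual (f i) (v i)
  exact ⟨_, IsDominatedBy.sum _ fun i _ => hS i⟩

theorem rnorm_sum_smulRight_le {n : ℕ} (f : Fin n → X →L[ℝ] ℝ) (v : Fin n → X) :
    rnorm (∑ i, (f i).smulRight (v i)) ≤ ∑ i, ‖f i‖ * ‖v i‖ := by
  choose S hS hSn using fun i => exists_isDominatedBy_smulRight hdual (f i) (v i)
  exact (IsDominatedBy.sum Finset.univ fun i _ => hS i).rnorm_le.trans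
    ((norm_sum_le _ _).trans (Finset.sum_le_sum fun i _ => hSn i))

/-- If `e n → 1` strongly, then `e n ∘ b → b` in the regular norm for finite-rank `b`. -/
theorem tendsto_rnorm_comp_sub {e : ℕ → X →L[ℝ] X}
    (he : ∀ y, Tendsto (fun n => e n y) atTop (𝓝 y)) {b : X →L[ℝ] X} (hb : FinRankOp b) :
    Tendsto (fun n => rnorm (e n ∘L b - b)) atTop (𝓝 0) := by
  obtain ⟨k, f, v, rfl⟩ := hb
  have hlim : Tendsto (fun n => ∑ i, ‖f i‖ * ‖e n (v i) - v i‖) atTop (𝓝 0) := by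
    have : ∀ i, Tendsto (fun n => ‖f i‖ * ‖e n (v i) - v i‖) atTop (𝓝 0) := fun i => by
      simpa using (((he (v i)).sub_const (v i)).norm).const_mul ‖f i‖
    simpa using tendsto_finsetSum Finset.univ fun i _ => this i
  refine squeeze_zero (fun n => rnorm_nonneg _) (fun n => ?_) hlim
  convert rnorm_sum_smulRight_le hdual f fun i => e n (v i) - v i
  ext y
  simp [smul_sub]

/-- If `l ∘ e n → l` in norm for every functional `l`, then `b ∘ e n → b` in the regular norm for
finite-rank `b`. -/
theorem tendsto_rnorm_sub_comp {e : ℕ → X →L[ℝ] X}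
    (he : ∀ l : X →L[ℝ] ℝ, Tendsto (fun n => ‖l ∘L e n - l‖) atTop (𝓝 0)) {b : X →L[ℝ] X}
    (hb : FinRankOp b) : Tendsto (fun n => rnorm (b ∘L e n - b)) atTop (𝓝 0) := by
  obtain ⟨k, f, v, rfl⟩ := hb
  have hlim : Tendsto (fun n => ∑ i, ‖f i ∘L e n - f i‖ * ‖v i‖) atTop (𝓝 0) := by
    have : ∀ i, Tendsto (fun n => ‖f i ∘L e n - f i‖ * ‖v i‖) atTop (𝓝 0) := fun i => by
      simpa using (he (f i)).mul_const ‖v i‖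
    simpa using tendsto_finsetSum Finset.univ fun i _ => this i
  refine squeeze_zero (fun n => rnorm_nonneg _) (fun n => ?_) hlim
  convert rnorm_sum_smulRight_le hdual (fun i => f i ∘L e n - f i) v
  ext y
  simp [sub_smul]

/-- The seminorm `a ↦ ‖ab‖ᵣ + ‖ba‖ᵣ` for a finite-rank operator `b`. -/
noncomputable def strictSeminorm : SeminormFamily ℝ (X →L[ℝ] X) {b : X →L[ℝ] X // FinRankOp b} :=
  fun b => Seminorm.ofSMulLE (fun a => rnorm (a ∘L b.1) + rnorm (b.1 ∘L a))
    (by simp [rnorm_zero])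
    (fun a a' => by
      have h1 := rnorm_add_le ((b.2.comp_left a).exists_isDominatedBy hdual)
        ((b.2.comp_left a').exists_isDominatedBy hdual)
      have h2 := rnorm_add_le ((b.2.comp_right a).exists_isDominatedBy hdual)
        ((b.2.comp_right a').exists_isDominatedBy hdual)
      rw [ContinuousLinearMap.add_comp, ContinuousLinearMap.comp_add]
      linarith)
    (fun c a => by
      have h1 := rnorm_smul_le ((b.2.comp_left a).exists_isDominatedBy hdual) c
      have h2 := rnorm_smul_le ((b.2.comp_right a).exists_isDominatedBy hdual) c
      rw [ContinuousLinearMap.smul_comp, ContinuousLinearMap.comp_smul, Real.norm_eq_abs, mul_add]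
      exact add_le_add h1 h2)

theorem strictSeminorm_apply (b : {b : X →L[ℝ] X // FinRankOp b}) (a : X →L[ℝ] X) :
    strictSeminorm hdual b a = rnorm (a ∘L b.1) + rnorm (b.1 ∘L a) := rfl

theorem withSeminorms_strictTopology :
    @WithSeminorms ℝ (X →L[ℝ] X) _ _ _ _ (strictSeminorm hdual) (strictTopology X) := by
  convert withSeminorms_generateFrom (strictSeminorm hdual) using 1
  classical
  unfold strictTopology
  congr 1
  ext U
  constructor
  · rintro ⟨a₀, s, ε, hε, hs, rfl⟩
    refine ⟨a₀, s.subtype FinRankOp, ε, hε, ?_⟩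
    ext y
    simp only [Set.mem_ofPred_eq, Finset.mem_subtype, strictSeminorm_apply, Subtype.forall]
    exact ⟨fun h b _ hb => h b hb, fun h b hb => h b (hs b hb) hb⟩
  · rintro ⟨a₀, s, ε, hε, rfl⟩
    refine ⟨a₀, s.map (Function.Embedding.subtype _), ε, hε, ?_, ?_⟩
    · intro b hb
      obtain ⟨c, -, rfl⟩ := Finset.mem_map.1 hb
      exact c.2
    · ext y
      simp [strictSeminorm_apply]

/-- Evaluation at a point is continuous for the strict topology. -/
theorem continuous_eval_strictTopology {l : X →L[ℝ] ℝ} {u : X} (hlu : l u = 1) (y : X) :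
    @Continuous _ _ (strictTopology X) _ (fun a : X →L[ℝ] X => a y) := by
  have hW := withSeminorms_strictTopology hdual
  let b : {b : X →L[ℝ] X // FinRankOp b} := ⟨l.smulRight y, finRankOp_smulRight l y⟩
  let L : (X →L[ℝ] X) →ₗ[ℝ] X :=
    { toFun := fun a => a y, map_add' := fun _ _ => rfl, map_smul' := fun _ _ => rfl }
  refine WithSeminorms.continuous_of_isBounded hW (norm_withSeminorms ℝ X) L
    (Seminorm.IsBounded.of_real fun _ => ⟨{b}, ‖u‖, fun a => ?_⟩)
  rw [Finset.sup_singleton, strictSeminorm_apply]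
  calc ‖a y‖ = ‖(a ∘L b.1) u‖ := by simp [b, hlu]
    _ ≤ ‖a ∘L b.1‖ * ‖u‖ := (a ∘L b.1).le_opNorm u
    _ ≤ (rnorm (a ∘L b.1) + rnorm (b.1 ∘L a)) * ‖u‖ := by
      refine mul_le_mul_of_nonneg_right ?_ (norm_nonneg u)
      exact (norm_le_rnorm ((b.2.comp_left a).exists_isDominatedBy hdual)).trans
        (le_add_of_nonneg_right (rnorm_nonneg _))
    _ = ‖u‖ * _ := mul_comm _ _

theorem continuous_comp_left_strictTopology {a : X →L[ℝ] X} (ha : ∃ S, IsDominatedBy a S) :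
    @Continuous _ _ (strictTopology X) (strictTopology X) (fun b => a ∘L b) := by
  obtain ⟨S, hS⟩ := ha
  have hW := withSeminorms_strictTopology hdual
  let L : (X →L[ℝ] X) →ₗ[ℝ] (X →L[ℝ] X) :=
    { toFun := fun b => a ∘L b
      map_add' := fun b c => ContinuousLinearMap.comp_add a b c
      map_smul' := fun r b => ContinuousLinearMap.comp_smul a r b }
  refine WithSeminorms.continuous_of_isBounded hW hW L
    (Seminorm.IsBounded.of_real fun c => ?_)
  classical
  let d : {b : X →L[ℝ] X // FinRankOp b} := ⟨c.1 ∘L a, c.2.comp_right a⟩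
  refine ⟨{c, d}, ‖S‖ + 1, fun b => ?_⟩
  have hc : strictSeminorm hdual c b ≤ (({c, d} : Finset _).sup (strictSeminorm hdual)) b :=
    Seminorm.le_finset_sup_apply (Finset.mem_insert_self _ _)
  have hd : strictSeminorm hdual d b ≤ (({c, d} : Finset _).sup (strictSeminorm hdual)) b :=
    Seminorm.le_finset_sup_apply (Finset.mem_insert_of_mem (Finset.mem_singleton_self _))
  have h1 : rnorm ((a ∘L b) ∘L c.1) ≤ ‖S‖ * rnorm (b ∘L c.1) := by
    rw [ContinuousLinearMap.comp_assoc]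
    exact hS.rnorm_comp_left_le ((c.2.comp_left b).exists_isDominatedBy hdual)
  have h2 : rnorm (b ∘L c.1) ≤ strictSeminorm hdual c b :=
    le_add_of_nonneg_right (rnorm_nonneg _)
  have h3 : rnorm (c.1 ∘L (a ∘L b)) ≤ strictSeminorm hdual d b := by
    rw [← ContinuousLinearMap.comp_assoc]
    exact le_add_of_nonneg_left (rnorm_nonneg _)
  rw [add_mul, one_mul]
  exact add_le_add (h1.trans (mul_le_mul_of_nonneg_left (h2.trans hc) (norm_nonneg S)))
    (h3.trans hd)

theorem continuous_comp_right_strictTopology {a : X →L[ℝ] X} (ha : ∃ S, IsDominatedBy a S) :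
    @Continuous _ _ (strictTopology X) (strictTopology X) (fun b => b ∘L a) := by
  obtain ⟨S, hS⟩ := ha
  have hW := withSeminorms_strictTopology hdual
  let L : (X →L[ℝ] X) →ₗ[ℝ] (X →L[ℝ] X) :=
    { toFun := fun b => b ∘L a
      map_add' := fun b c => ContinuousLinearMap.add_comp b c a
      map_smul' := fun r b => ContinuousLinearMap.smul_comp r b a }
  refine WithSeminorms.continuous_of_isBounded hW hW L
    (Seminorm.IsBounded.of_real fun c => ?_)
  classical
  let d : {b : X →L[ℝ] X // FinRankOp b} := ⟨a ∘L c.1, c.2.comp_left a⟩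
  refine ⟨{c, d}, ‖S‖ + 1, fun b => ?_⟩
  have hc : strictSeminorm hdual c b ≤ (({c, d} : Finset _).sup (strictSeminorm hdual)) b :=
    Seminorm.le_finset_sup_apply (Finset.mem_insert_self _ _)
  have hd : strictSeminorm hdual d b ≤ (({c, d} : Finset _).sup (strictSeminorm hdual)) b :=
    Seminorm.le_finset_sup_apply (Finset.mem_insert_of_mem (Finset.mem_singleton_self _))
  have h1 : rnorm (c.1 ∘L (b ∘L a)) ≤ ‖S‖ * rnorm (c.1 ∘L b) :=
    hS.rnorm_comp_right_le (T := c.1 ∘L b) ((c.2.comp_right b).exists_isDominatedBy hdual)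
  have h2 : rnorm (c.1 ∘L b) ≤ strictSeminorm hdual c b :=
    le_add_of_nonneg_left (rnorm_nonneg _)
  have h3 : rnorm ((b ∘L a) ∘L c.1) ≤ strictSeminorm hdual d b :=
    le_add_of_nonneg_right (rnorm_nonneg _)
  rw [add_mul, one_mul, add_comm]
  exact (add_comm _ _).trans_le
    (add_le_add (h1.trans (mul_le_mul_of_nonneg_left (h2.trans hc) (norm_nonneg S)))
      (h3.trans hd)) |>.trans_eq (add_comm _ _)

theorem tendsto_strictTopology_iff {u : ℕ → X →L[ℝ] X} {a : X →L[ℝ] X} :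
    @Tendsto _ _ u atTop (@nhds _ (strictTopology X) a) ↔ ∀ b, FinRankOp b →
      Tendsto (fun n => rnorm ((u n - a) ∘L b) + rnorm (b ∘L (u n - a))) atTop (𝓝 0) := by
  refine (@WithSeminorms.tendsto_nhds _ _ _ _ _ _ _ (strictTopology X) _
    (withSeminorms_strictTopology hdual) u atTop a).trans ?_
  simp only [Subtype.forall, strictSeminorm_apply]
  refine forall₂_congr fun b _ => ⟨fun h => ?_, fun h ε hε => h.eventually_lt_const hε⟩
  refine tendsto_order.2 ⟨fun r hr => .of_forall fun n => ?_, h⟩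
  exact hr.trans_le (add_nonneg (rnorm_nonneg _) (rnorm_nonneg _))

/-- If `e n → 1` strongly and `l ∘ e n → l` in norm for every functional `l`, then `(e n)` is a
left approximate identity for the strict topology on dominated operators. -/
theorem tendsto_approxIdentity_comp {e : ℕ → X →L[ℝ] X}
    (he : ∀ y, Tendsto (fun n => e n y) atTop (𝓝 y))
    (he' : ∀ l : X →L[ℝ] ℝ, Tendsto (fun n => ‖l ∘L e n - l‖) atTop (𝓝 0))
    {a : X →L[ℝ] X} (ha : ∃ S, IsDominatedBy a S) :
    @Tendsto _ _ (fun n => e n ∘L a) atTop (@nhds _ (strictTopology X) a) := by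
  obtain ⟨S, hS⟩ := ha
  refine (tendsto_strictTopology_iff hdual).2 fun b hb => ?_
  have hlim := (tendsto_rnorm_comp_sub hdual he (hb.comp_left a)).add
    ((tendsto_rnorm_sub_comp hdual he' hb).const_mul ‖S‖)
  rw [mul_zero, add_zero] at hlim
  refine squeeze_zero (fun n => add_nonneg (rnorm_nonneg _) (rnorm_nonneg _)) (fun n => ?_) hlim
  have hT : FinRankOp (b ∘L (e n - 1)) := hb.comp_right _
  rw [ContinuousLinearMap.comp_sub] at hT
  refine add_le_add (le_of_eq ?_) ?_
  · rw [ContinuousLinearMap.sub_comp]; rfl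
  · have := hS.rnorm_comp_right_le (hT.exists_isDominatedBy hdual)
    rw [ContinuousLinearMap.sub_comp, ContinuousLinearMap.comp_assoc] at this
    rw [ContinuousLinearMap.comp_sub]
    exact this

/-- If `e n → 1` strongly and `l ∘ e n → l` in norm for every functional `l`, then `(e n)` is a
right approximate identity for the strict topology on dominated operators. -/
theorem tendsto_comp_approxIdentity {e : ℕ → X →L[ℝ] X}
    (he : ∀ y, Tendsto (fun n => e n y) atTop (𝓝 y))
    (he' : ∀ l : X →L[ℝ] ℝ, Tendsto (fun n => ‖l ∘L e n - l‖) atTop (𝓝 0))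
    {a : X →L[ℝ] X} (ha : ∃ S, IsDominatedBy a S) :
    @Tendsto _ _ (fun n => a ∘L e n) atTop (@nhds _ (strictTopology X) a) := by
  obtain ⟨S, hS⟩ := ha
  refine (tendsto_strictTopology_iff hdual).2 fun b hb => ?_
  have hlim := ((tendsto_rnorm_comp_sub hdual he hb).const_mul ‖S‖).add
    (tendsto_rnorm_sub_comp hdual he' (hb.comp_right a))
  rw [mul_zero, zero_add] at hlim
  refine squeeze_zero (fun n => add_nonneg (rnorm_nonneg _) (rnorm_nonneg _)) (fun n => ?_) hlim
  have hT : FinRankOp ((e n - 1) ∘L b) := hb.comp_left _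
  rw [ContinuousLinearMap.sub_comp] at hT
  refine add_le_add ?_ (le_of_eq ?_)
  · have := hS.rnorm_comp_left_le (hT.exists_isDominatedBy hdual)
    rwa [ContinuousLinearMap.comp_sub, ← ContinuousLinearMap.comp_assoc] at this
  · rw [ContinuousLinearMap.comp_sub]; rfl

end RegularNorm

theorem strict_topology_properties
    {X : Type*} [NormedAddCommGroup X] [Lattice X] [HasSolidNorm X] [IsOrderedAddMonoid X] [NormedSpace ℝ X] [CompleteSpace X]
    -- X is order complete:
    (hXoc : ∀ S : Set X, S.Nonempty → BddAbove S → ∃ b, IsLUB S b)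
    -- the normalized atoms of X form a Schauder basis (x i), biorthogonal (xs i):
    (x : ℕ → X) (xs : ℕ → X →L[ℝ] ℝ)
    (hatom : ∀ i, IsNormAtom (x i))
    (hall : ∀ a : X, IsNormAtom a → ∃ i, x i = a)
    (hbi : ∀ i j, xs i (x j) = if i = j then (1 : ℝ) else 0)
    (hbasis : ∀ y : X, Tendsto (fun n => ∑ i ∈ Finset.range n, xs i y • x i) atTop (𝓝 y))
    -- 𝒜 is a closed Riesz algebra ideal of ℒʳ(X) containing all e n:
    (A : Set (X →L[ℝ] X))
    (hAsub : A ⊆ LrSet X)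
    (hAadd : ∀ a ∈ A, ∀ b ∈ A, a + b ∈ A)
    (hAsmul : ∀ (c : ℝ), ∀ a ∈ A, c • a ∈ A)
    (hAideal : ∀ a ∈ A, ∀ T ∈ LrSet X, T ∘L a ∈ A ∧ a ∘L T ∈ A)
    (hARiesz : ∀ a ∈ A, ∃ m ∈ A, opLe a m ∧ opLe (-a) m ∧
      ∀ c ∈ LrSet X, opLe a c → opLe (-a) c → opLe m c)
    (hAclosed : ∀ T ∈ LrSet X, (∀ ε : ℝ, 0 < ε → ∃ a ∈ A, rnorm (T - a) < ε) → T ∈ A)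
    (hAe : ∀ n : ℕ, (∑ i ∈ Finset.range n, (xs i).smulRight (x i)) ∈ A) :
    -- let τ be the strict topology:
    -- (a) (𝒜, τ) is a Hausdorff locally convex topological vector space with
    --     separately continuous multiplication:
    (@IsTopologicalAddGroup (X →L[ℝ] X) (strictTopology X) _) ∧
    (@ContinuousSMul ℝ (X →L[ℝ] X) _ _ (strictTopology X)) ∧
    (@LocallyConvexSpace ℝ (X →L[ℝ] X) _ _ _ _ (strictTopology X)) ∧
    (@T2Space {a : X →L[ℝ] X // a ∈ A}
      (TopologicalSpace.induced Subtype.val (strictTopology X))) ∧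
    (∀ a ∈ A, @Continuous _ _ (strictTopology X) (strictTopology X) (fun b => a ∘L b) ∧
              @Continuous _ _ (strictTopology X) (strictTopology X) (fun b => b ∘L a)) ∧
    -- (b) 𝒜₊ is τ-closed (relatively in 𝒜):
    (∀ a ∈ A, a ∈ @closure _ (strictTopology X) {b | b ∈ A ∧ IsPosOp b} → IsPosOp a) ∧
    -- (c) if the basis is shrinking, (e n) is a τ-approximate identity for 𝒜:
    ((∀ l : X →L[ℝ] ℝ,
        Tendsto (fun n => ‖l - ∑ i ∈ Finset.range n, l (x i) • xs i‖) atTop (𝓝 0)) →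
      ∀ a ∈ A,
        @Filter.Tendsto ℕ (X →L[ℝ] X)
          (fun n => (∑ i ∈ Finset.range n, (xs i).smulRight (x i)) ∘L a) atTop
          (@nhds _ (strictTopology X) a) ∧
        @Filter.Tendsto ℕ (X →L[ℝ] X)
          (fun n => a ∘L (∑ i ∈ Finset.range n, (xs i).smulRight (x i))) atTop
          (@nhds _ (strictTopology X) a)) := by
  have hdual := exists_dominating_functional hatom hbi hbasis
  have hW := withSeminorms_strictTopology hdual
  have hdom : ∀ a ∈ A, ∃ S, IsDominatedBy a S := fun a ha =>
    exists_isDominatedBy_of_mem_LrSet (hAsub ha)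
  have heval := continuous_eval_strictTopology hdual (l := xs 0) (u := x 0) (by simp [hbi])
  refine ⟨@WithSeminorms.topologicalAddGroup _ _ _ _ _ _ (strictTopology X) _ hW,
    @WithSeminorms.continuousSMul _ _ _ _ _ _ (strictTopology X) _ hW,
    @WithSeminorms.toLocallyConvexSpace ℝ _ _ _ _ _ _ _ _ (strictTopology X) _ hW, ?_,
    fun a ha => ⟨continuous_comp_left_strictTopology hdual (hdom a ha),
      continuous_comp_right_strictTopology hdual (hdom a ha)⟩, ?_, ?_⟩
  · let _ : TopologicalSpace {a : X →L[ℝ] X // a ∈ A} :=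
      TopologicalSpace.induced Subtype.val (strictTopology X)
    have hcont : Continuous fun (a : {a : X →L[ℝ] X // a ∈ A}) (y : X) => a.1 y :=
      continuous_pi fun y =>
        @Continuous.comp _ _ _ _ (strictTopology X) _ _ _ (heval y) continuous_induced_dom
    exact T2Space.of_injective_continuous
      (fun a b h => Subtype.ext (ContinuousLinearMap.ext fun y => congrFun h y)) hcont
  · intro a _ hcl y hy
    have hclosed : @IsClosed _ (strictTopology X) {b : X →L[ℝ] X | 0 ≤ b y} :=
      @IsClosed.preimage _ _ (strictTopology X) _ _ (heval y) _ isClosed_nonneg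
    have hsub := @closure_minimal _ (strictTopology X) {b | b ∈ A ∧ IsPosOp b} {b | 0 ≤ b y}
      (fun b hb => hb.2 y hy) hclosed
    exact hsub hcl
  · intro hshrink a ha
    have he : ∀ y, Tendsto (fun n => (∑ i ∈ Finset.range n, (xs i).smulRight (x i)) y)
        atTop (𝓝 y) := fun y => by simpa using hbasis y
    have he' : ∀ l : X →L[ℝ] ℝ, Tendsto (fun n =>
        ‖l ∘L (∑ i ∈ Finset.range n, (xs i).smulRight (x i)) - l‖) atTop (𝓝 0) := fun l => by
      refine (hshrink l).congr fun n => ?_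
      rw [norm_sub_rev]
      congr 2
      ext y
      simp [mul_comm]
    exact ⟨tendsto_approxIdentity_comp hdual he he' (hdom a ha),
      tendsto_comp_approxIdentity hdual he he' (hdom a ha)⟩
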